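/- Let a and b be real numbers with a > b > 0. The anthyphairesis of a to b is finite (r n = 0 for some n) if and only if the ratio a / b is a rational number. -/

import Mathlib

open Classical in
/-- The anthyphairetic remainder sequence of `a` to `b`:
`r 0 = a`, `r 1 = b`, and `r (n+2) = 0` if `r (n+1) = 0`, otherwise
`r (n+2) = r n - ⌊r n / r (n+1)⌋ * r (n+1)`. -/
noncomputable def anthRem (a b : ℝ) : ℕ → ℝ
  | 0 => a
  | 1 => b
  | n + 2 =>
    if anthRem a b (n + 1) = 0 then 0
    else anthRem a b n - (⌊anthRem a b n / anthRem a b (n + 1)⌋ : ℝ) * anthRem a b (n + 1)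

/-- Two positive reals are commensurable if they are positive natural multiples
of a common measure `c > 0`. -/
def AreCommensurable (a b : ℝ) : Prop :=
  ∃ c : ℝ, 0 < c ∧ ∃ m n : ℕ, 0 < m ∧ 0 < n ∧ a = (m : ℝ) * c ∧ b = (n : ℝ) * c

theorem anthRem_add_two {a b : ℝ} {n : ℕ} (h : anthRem a b (n + 1) ≠ 0) :
    anthRem a b (n + 2) = anthRem a b n -
      (⌊anthRem a b n / anthRem a b (n + 1)⌋ : ℝ) * anthRem a b (n + 1) := by
  rw [anthRem, if_neg h]

theorem anthRem_add_two_nonneg {a b : ℝ} {n : ℕ} (h : 0 < anthRem a b (n + 1)) :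
    0 ≤ anthRem a b (n + 2) := by
  rw [anthRem_add_two h.ne', sub_nonneg]
  exact (le_div_iff₀ h).mp (Int.floor_le _)

theorem anthRem_add_two_lt {a b : ℝ} {n : ℕ} (h : 0 < anthRem a b (n + 1)) :
    anthRem a b (n + 2) < anthRem a b (n + 1) := by
  have := (div_lt_iff₀ h).mp (Int.lt_floor_add_one (anthRem a b n / anthRem a b (n + 1)))
  rw [anthRem_add_two h.ne']
  linarith

/-- A common measure of two consecutive remainders also measures `a` and `b`, as long as no
earlier remainder vanishes. -/
theorem exists_int_mul_of_anthRem {a b c : ℝ} (n : ℕ) (hne : ∀ k ≤ n, anthRem a b k ≠ 0)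
    (h₀ : ∃ k : ℤ, anthRem a b n = k * c) (h₁ : ∃ l : ℤ, anthRem a b (n + 1) = l * c) :
    (∃ k : ℤ, a = k * c) ∧ ∃ l : ℤ, b = l * c := by
  induction n with
  | zero => exact ⟨by simpa only [anthRem] using h₀, by simpa only [anthRem] using h₁⟩
  | succ n ih =>
    refine ih (fun k hk => hne k (by omega)) ?_ h₀
    obtain ⟨k, hk⟩ := h₀
    obtain ⟨l, hl⟩ := h₁
    have h := anthRem_add_two (hne (n + 1) le_rfl)
    refine ⟨l + ⌊anthRem a b n / anthRem a b (n + 1)⌋ * k, ?_⟩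
    push_cast
    linear_combination hl - h + (⌊anthRem a b n / anthRem a b (n + 1)⌋ : ℝ) * hk

/-- If `c` measures `a` and `b = d * c`, then `c` measures all remainders, and the multiples
decrease as long as no remainder vanishes. -/
theorem exists_int_mul_anthRem {a b c : ℝ} (hb : 0 < b) (hc : 0 < c) {m d : ℤ}
    (ha : a = m * c) (hd : b = d * c) (hne : ∀ n, anthRem a b n ≠ 0) (n : ℕ) :
    0 < anthRem a b (n + 1) ∧ (∃ k : ℤ, anthRem a b n = k * c) ∧
      ∃ l : ℤ, anthRem a b (n + 1) = l * c ∧ l + n ≤ d := by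
  induction n with
  | zero =>
    simp only [anthRem]
    exact ⟨hb, ⟨m, ha⟩, d, hd, by simp⟩
  | succ n ih =>
    obtain ⟨hpos, ⟨k, hk⟩, l, hl, hle⟩ := ih
    have h := anthRem_add_two hpos.ne'
    have hlt := anthRem_add_two_lt hpos
    have hmul : anthRem a b (n + 2) =
        ((k - ⌊anthRem a b n / anthRem a b (n + 1)⌋ * l : ℤ) : ℝ) * c := by
      push_cast
      linear_combination h + hk - (⌊anthRem a b n / anthRem a b (n + 1)⌋ : ℝ) * hl
    refine ⟨(anthRem_add_two_nonneg hpos).lt_of_ne' (hne _), ⟨l, hl⟩, _, hmul, ?_⟩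
    replace hlt := hmul.symm.trans_lt (hlt.trans_eq hl)
    have := Int.cast_lt.mp (lt_of_mul_lt_mul_right hlt hc.le)
    push_cast
    omega

/-- The anthyphairesis of `a` to `b` is finite if and only if the ratio `a / b`
is a rational number. -/
theorem finite_anthyphairesis_iff_ratio_rational
    (a b : ℝ) (hab : a > b) (hb : b > 0) :
    (∃ n : ℕ, anthRem a b n = 0) ↔ ∃ q : ℚ, (q : ℝ) = a / b := by
  constructor
  · intro hex
    classical
    obtain ⟨n, hn, hmin⟩ : ∃ n, anthRem a b n = 0 ∧ ∀ k < n, anthRem a b k ≠ 0 :=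
      ⟨Nat.find hex, Nat.find_spec hex, fun k hk => Nat.find_min hex hk⟩
    cases n with
    | zero =>
      simp only [anthRem] at hn
      linarith
    | succ n =>
      obtain ⟨⟨k, hk⟩, l, hl⟩ := exists_int_mul_of_anthRem (c := anthRem a b n) n
        (fun k hk => hmin k (by omega)) ⟨1, by simp⟩ ⟨0, by simp [hn]⟩
      refine ⟨(k : ℚ) / l, ?_⟩
      push_cast
      rw [← mul_div_mul_right (k : ℝ) (l : ℝ) (hmin n (by omega)), ← hk, ← hl]
  · rintro ⟨q, hq⟩
    by_contra! hne
    have hden : (0 : ℝ) < q.den := by exact_mod_cast q.den_pos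
    have ha : a = (q.num : ℝ) * (b / q.den) := by
      rw [Rat.cast_def, div_eq_div_iff hden.ne' hb.ne'] at hq
      field_simp
      linarith
    have hd : b = ((q.den : ℤ) : ℝ) * (b / q.den) := by
      push_cast
      field_simp
    have hc : 0 < b / q.den := div_pos hb hden
    obtain ⟨hpos, -, l, hl, hle⟩ := exists_int_mul_anthRem hb hc ha hd hne q.den
    rw [hl] at hpos
    have : 0 < l := Int.cast_pos.mp (pos_of_mul_pos_left hpos hc.le)
    omega
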